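/- arXiv:math/9309213 — 2 statements merged into one kernel-verified Lean document; each statement's English description precedes it below -/
import Mathlib

section
/- For every nonnegative integer n and every real x, the function (s,t) ↦ p_n(x; 1/s, 1/t), defined for s,t>0, extends to a continuous function on the closed quadrant [0,∞)². -/
open Filter Real

/-- Pochhammer symbol `(a)_m = a (a+1) ⋯ (a+m-1)`. -/
noncomputable def poch (a : ℝ) (m : ℕ) : ℝ := ∏ j ∈ Finset.range m, (a + j)

/-- Monic Hermite polynomial of degree `n`. -/
noncomputable def monicHermite (n : ℕ) (x : ℝ) : ℝ :=
  (n.factorial : ℝ) * ∑ m ∈ Finset.range (n / 2 + 1),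
    (-1 : ℝ) ^ m * x ^ (n - 2 * m) / (4 ^ m * m.factorial * (n - 2 * m).factorial)

/-- Monic Laguerre polynomial of degree `n` with parameter `α`. -/
noncomputable def monicLaguerre (α : ℝ) (n : ℕ) (x : ℝ) : ℝ :=
  (-1 : ℝ) ^ n * n.factorial * ∑ k ∈ Finset.range (n + 1),
    (-1 : ℝ) ^ k * (poch (α + k + 1) (n - k) / ((n - k).factorial * k.factorial)) * x ^ k

/-- Monic Jacobi polynomial of degree `n` with parameters `α, β`. -/
noncomputable def monicJacobi (α β : ℝ) (n : ℕ) (x : ℝ) : ℝ :=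
  ((n.factorial : ℝ) / poch (n + α + β + 1) n) *
    ∑ k ∈ Finset.range (n + 1),
      (poch (n + α - k + 1) k / k.factorial) *
      (poch (β + k + 1) (n - k) / (n - k).factorial) *
      (x - 1) ^ (n - k) * (x + 1) ^ k

/-- Monic Racah polynomial of degree `n` in the variable `y`. -/
noncomputable def monicRacah (α β N δ : ℝ) (n : ℕ) (y : ℝ) : ℝ :=
  (1 / poch (n + α + β + 1) n) *
    ∑ k ∈ Finset.range (n + 1),
      (poch (-(n : ℝ)) k * poch (n + α + β + 1) k / k.factorial) *
      poch (α + k + 1) (n - k) * poch (β + δ + k + 1) (n - k) * poch (k - N) (n - k) *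
      ∏ j ∈ Finset.range k, ((j : ℝ) * (j + δ - N) - y)

/-- Monic Hahn polynomial of degree `n`. -/
noncomputable def monicHahn (α β N : ℝ) (n : ℕ) (x : ℝ) : ℝ :=
  (1 / poch (n + α + β + 1) n) *
    ∑ k ∈ Finset.range (n + 1),
      (poch (-(n : ℝ)) k * poch (n + α + β + 1) k * poch (-x) k / k.factorial) *
      poch (α + k + 1) (n - k) * poch (k - N) (n - k)

/-- Monic Meixner polynomial of degree `n`. -/
noncomputable def monicMeixner (b c : ℝ) (n : ℕ) (x : ℝ) : ℝ :=
  (c / (c - 1)) ^ n * ∑ k ∈ Finset.range (n + 1),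
    (poch (-(n : ℝ)) k * poch (-x) k / k.factorial) * poch (b + k) (n - k) * (1 - 1 / c) ^ k

/-- Monic Krawtchouk polynomial of degree `n`. -/
noncomputable def monicKrawtchouk (p N : ℝ) (n : ℕ) (x : ℝ) : ℝ :=
  p ^ n * ∑ k ∈ Finset.range (n + 1),
    (poch (-(n : ℝ)) k * poch (-x) k / k.factorial) * poch (k - N) (n - k) * (1 / p) ^ k

/-- `ρ = (α+β)^{3/2} / (αβ)^{1/2}`. -/
noncomputable def jacobiRho (α β : ℝ) : ℝ := (α + β) ^ ((3 : ℝ) / 2) / Real.sqrt (α * β)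

/-- `σ = (α-β)/(α+β)`. -/
noncomputable def jacobiSigma (α β : ℝ) : ℝ := (α - β) / (α + β)

/-- Uniformly rescaled monic Jacobi polynomial `p_n(x; α, β) = ρ^n p_n^{(α,β)}(ρ⁻¹x - σ)`. -/
noncomputable def rescaledJacobi (α β : ℝ) (n : ℕ) (x : ℝ) : ℝ :=
  jacobiRho α β ^ n * monicJacobi α β n (x / jacobiRho α β - jacobiSigma α β)

/-- `ρ = ((α+β)³/(αβ(β+δ)(N+α+β)(δ-α)N))^{1/2}` with `β = bα`, `δ = (bdν+1)α`, `N = bν`. -/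
noncomputable def racahRho (α b d ν : ℝ) : ℝ :=
  Real.sqrt ((α + b * α) ^ 3 /
    (α * (b * α) * (b * α + (b * d * ν + 1) * α) * (b * ν + α + b * α) *
      ((b * d * ν + 1) * α - α) * (b * ν)))

/-- `σ = -N(α+1)(β+δ+1)/(α+β+2)` with `β = bα`, `δ = (bdν+1)α`, `N = bν`. -/
noncomputable def racahSigma (α b d ν : ℝ) : ℝ :=
  -((b * ν) * (α + 1) * (b * α + (b * d * ν + 1) * α + 1)) / (α + b * α + 2)

/-- Rescaled monic Racah polynomial `p_n(x; α, b, d, ν) = ρ^n r_n(ρ⁻¹x - σ; α, bα, bν, (bdν+1)α)`. -/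
noncomputable def rescaledRacah (α b d ν : ℝ) (n : ℕ) (x : ℝ) : ℝ :=
  racahRho α b d ν ^ n *
    monicRacah α (b * α) (b * ν) ((b * d * ν + 1) * α) n
      (x / racahRho α b d ν - racahSigma α b d ν)
open Polynomial in
/-- Homogeneous form of the Jacobi polynomial of degree `n`, with `y - 1` and `y + 1` replaced by
`X - a` and `X - b`. -/
noncomputable def jacobiPoly (α β a b : ℝ) (n : ℕ) : ℝ[X] :=
  C ((n.factorial : ℝ) / poch (n + α + β + 1) n) *
    ∑ k ∈ Finset.range (n + 1),
      C ((poch (n + α - k + 1) k / k.factorial) * (poch (β + k + 1) (n - k) / (n - k).factorial)) *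
      ((X - C a) ^ (n - k) * (X - C b) ^ k)

lemma poch_succ_left (a : ℝ) (m : ℕ) : poch a (m + 1) = a * poch (a + 1) m := by
  simp only [poch, Finset.prod_range_succ']
  rw [mul_comm]
  congr 1
  · simp
  · refine Finset.prod_congr rfl fun j _ => ?_
    push_cast; ring

lemma poch_pos {a : ℝ} (ha : 0 < a) (m : ℕ) : 0 < poch a m :=
  Finset.prod_pos fun j _ => by positivity

lemma poch_eq_smeval (a : ℝ) (m : ℕ) : poch a m = (ascPochhammer ℕ m).smeval a := by
  induction m with
  | zero => simp [poch]
  | succ m ih =>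
    rw [ascPochhammer_succ_right, Polynomial.smeval_mul, ← ih]
    simp [poch, Finset.prod_range_succ, Polynomial.smeval_add, Polynomial.smeval_natCast]

lemma poch_div_factorial_eq_choose (a : ℝ) (m : ℕ) :
    poch (a - m + 1) m / m.factorial = Ring.choose a m := by
  rw [poch_eq_smeval, ← Ring.factorial_nsmul_multichoose_eq_ascPochhammer, Ring.choose, nsmul_eq_mul]
  field_simp

lemma sum_jacobi_coeff (α β : ℝ) (n : ℕ) :
    ∑ k ∈ Finset.range (n + 1),
      (poch (n + α - k + 1) k / k.factorial) * (poch (β + k + 1) (n - k) / (n - k).factorial) =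
    poch (n + α + β + 1) n / n.factorial := by
  have h := Ring.add_choose_eq n (Commute.all ((n : ℝ) + α) (n + β))
  rw [Finset.Nat.sum_antidiagonal_eq_sum_range_succ
    (fun i j => Ring.choose ((n : ℝ) + α) i * Ring.choose ((n : ℝ) + β) j)] at h
  rw [← poch_div_factorial_eq_choose] at h
  rw [show (n : ℝ) + α + β + 1 = n + α + (n + β) - n + 1 by ring, h]
  refine Finset.sum_congr rfl fun k hk => ?_
  have hk : k ≤ n := by simpa [Nat.lt_succ_iff] using hk
  rw [← poch_div_factorial_eq_choose, ← poch_div_factorial_eq_choose, Nat.cast_sub hk]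
  ring_nf

lemma jacobi_coeff_succ (α β : ℝ) {n k : ℕ} (hk : k < n) :
    (poch (n + α - (k + 1 : ℕ) + 1) (k + 1) / (k + 1).factorial) *
      (poch (β + (k + 1 : ℕ) + 1) (n - (k + 1)) / (n - (k + 1)).factorial) *
      ((k + 1 : ℕ) * ((k + 1 : ℕ) + β)) =
    (poch (n + α - k + 1) k / k.factorial) * (poch (β + k + 1) (n - k) / (n - k).factorial) *
      ((n - k : ℕ) * ((n - k : ℕ) + α)) := by
  obtain ⟨m, rfl⟩ := Nat.exists_eq_add_of_lt hk
  rw [show k + m + 1 - (k + 1) = m by omega, show k + m + 1 - k = m + 1 by omega,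
    poch_succ_left, poch_succ_left (β + k + 1)]
  have e1 : ((k + m + 1 : ℕ) : ℝ) + α - (k + 1 : ℕ) + 1 + 1 = (k + m + 1 : ℕ) + α - k + 1 := by
    push_cast; ring
  have e2 : β + k + 1 + 1 = β + (k + 1 : ℕ) + 1 := by push_cast; ring
  rw [e1, e2, Nat.factorial_succ, Nat.factorial_succ]
  generalize poch ((k + m + 1 : ℕ) + α - k + 1) k = A
  generalize poch (β + (k + 1 : ℕ) + 1) m = B
  push_cast
  field_simp
  ring

open Polynomial in
lemma jacobiPoly_natDegree_le (α β a b : ℝ) (n : ℕ) : (jacobiPoly α β a b n).natDegree ≤ n := by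
  refine natDegree_C_mul_le _ _ |>.trans (natDegree_sum_le_of_forall_le _ _ fun k hk => ?_)
  have hk : k ≤ n := by simpa [Nat.lt_succ_iff] using hk
  refine (natDegree_C_mul_le _ _).trans ?_
  rw [((monic_X_sub_C a).pow _).natDegree_mul ((monic_X_sub_C b).pow _)]
  simp [natDegree_pow, hk]

open Polynomial in
lemma jacobiPoly_coeff_self {α β : ℝ} (hα : 0 < α) (hβ : 0 < β) (a b : ℝ) (n : ℕ) :
    (jacobiPoly α β a b n).coeff n = 1 := by
  have hp : 0 < poch (n + α + β + 1) n := poch_pos (by positivity) n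
  rw [jacobiPoly, coeff_C_mul, finsetSum_coeff]
  have h : ∀ k ∈ Finset.range (n + 1),
      (C ((poch (n + α - k + 1) k / k.factorial) *
        (poch (β + k + 1) (n - k) / (n - k).factorial)) *
        ((X - C a) ^ (n - k) * (X - C b) ^ k)).coeff n =
      (poch (n + α - k + 1) k / k.factorial) *
        (poch (β + k + 1) (n - k) / (n - k).factorial) := fun k hk => by
    have hk : k ≤ n := by simpa [Nat.lt_succ_iff] using hk
    have hm : ((X - C a) ^ (n - k) * (X - C b) ^ k).Monic :=
      ((monic_X_sub_C a).pow _).mul ((monic_X_sub_C b).pow _)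
    have hd : ((X - C a) ^ (n - k) * (X - C b) ^ k).natDegree = n := by
      rw [((monic_X_sub_C a).pow _).natDegree_mul ((monic_X_sub_C b).pow _)]
      simp [natDegree_pow, hk]
    have := hm.coeff_natDegree
    rw [hd] at this
    rw [coeff_C_mul, this, mul_one]
  rw [Finset.sum_congr rfl h, sum_jacobi_coeff]
  have := n.factorial_ne_zero
  field_simp

open Polynomial in
lemma jacobi_operator_monomial (α β a b : ℝ) (i k : ℕ) :
    (X - C a) * (X - C b) * derivative (derivative ((X - C a) ^ i * (X - C b) ^ k)) +
      (C (α + 1) * (X - C b) + C (β + 1) * (X - C a)) *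
        derivative ((X - C a) ^ i * (X - C b) ^ k) -
      C (((i : ℝ) + k) * (i + k + α + β + 1)) * ((X - C a) ^ i * (X - C b) ^ k) =
    C (i * (i + α)) * ((X - C a) ^ (i - 1) * (X - C b) ^ k * (C a - C b)) -
      C (k * (k + β)) * ((X - C a) ^ i * (X - C b) ^ (k - 1) * (C a - C b)) := by
  rcases i with _ | _ | i <;> rcases k with _ | _ | k <;>
    simp [derivative_mul, derivative_pow] <;> ring

open Polynomial in
/-- The Jacobi differential equation. -/
lemma jacobiPoly_ode (α β a b : ℝ) (n : ℕ) :
    (X - C a) * (X - C b) * derivative (derivative (jacobiPoly α β a b n)) +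
      (C (α + 1) * (X - C b) + C (β + 1) * (X - C a)) * derivative (jacobiPoly α β a b n) -
      C (n * (n + α + β + 1)) * jacobiPoly α β a b n = 0 := by
  set c : ℕ → ℝ := fun k =>
    (poch (n + α - k + 1) k / k.factorial) * (poch (β + k + 1) (n - k) / (n - k).factorial) with hc
  have hsum : ∑ k ∈ Finset.range (n + 1),
      (C (c k * ((n - k : ℕ) * ((n - k : ℕ) + α))) *
        ((X - C a) ^ (n - k - 1) * (X - C b) ^ k * (C a - C b)) -
      C (c k * (k * (k + β))) * ((X - C a) ^ (n - k) * (X - C b) ^ (k - 1) * (C a - C b))) = 0 := by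
    rw [Finset.sum_sub_distrib, Finset.sum_range_succ, Finset.sum_range_succ' _ n, sub_eq_zero]
    congr 1
    · refine Finset.sum_congr rfl fun k hk => ?_
      have := jacobi_coeff_succ α β (Finset.mem_range.1 hk)
      simp only [hc]
      rw [this, Nat.sub_sub, Nat.add_sub_cancel]
    · simp
  have hexp : jacobiPoly α β a b n = C ((n.factorial : ℝ) / poch (n + α + β + 1) n) *
    ∑ k ∈ Finset.range (n + 1), C (c k) * ((X - C a) ^ (n - k) * (X - C b) ^ k) := rfl
  rw [← mul_zero (C ((n.factorial : ℝ) / poch (n + α + β + 1) n)), ← hsum, hexp]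
  simp only [derivative_C_mul, derivative_sum, Finset.mul_sum]
  rw [← Finset.sum_add_distrib, ← Finset.sum_sub_distrib]
  refine Finset.sum_congr rfl fun k hk => ?_
  have hk : k ≤ n := by simpa [Nat.lt_succ_iff] using hk
  have h := jacobi_operator_monomial α β a b (n - k) k
  rw [show ((n - k : ℕ) : ℝ) + k = n by rw [Nat.cast_sub hk]; ring] at h
  rw [C_mul (a := c k), C_mul (a := c k)]
  linear_combination (C ((n.factorial : ℝ) / poch (n + α + β + 1) n) * C (c k)) * h

open Polynomial in
lemma jacobiPoly_coeff_rec (α β a b : ℝ) (n j : ℕ) :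
    ((n : ℝ) * (n + α + β + 1) - j * (j + α + β + 1)) * (jacobiPoly α β a b n).coeff j =
      a * b * ((j + 1) * (j + 2)) * (jacobiPoly α β a b n).coeff (j + 2) -
      ((a + b) * j + (α + 1) * b + (β + 1) * a) * (j + 1) *
        (jacobiPoly α β a b n).coeff (j + 1) := by
  have h := jacobiPoly_ode α β a b n
  generalize jacobiPoly α β a b n = Q at *
  have h1 : (X * derivative Q).coeff j = j * Q.coeff j := by
    rcases j with _ | j
    · simp
    · simp [coeff_X_mul, coeff_derivative]; ring
  have h2 : (X * derivative (derivative Q)).coeff j = j * (j + 1) * Q.coeff (j + 1) := by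
    rcases j with _ | j
    · simp
    · simp [coeff_X_mul, coeff_derivative]; ring
  have h3 : (X * (X * derivative (derivative Q))).coeff j = j * (j - 1) * Q.coeff j := by
    rcases j with _ | _ | j
    · simp
    · simp
    · simp [coeff_X_mul, coeff_derivative]; ring
  have h4 : X * (X * derivative (derivative Q)) - C (a + b) * (X * derivative (derivative Q)) +
      C (a * b) * derivative (derivative Q) + C (α + β + 2) * (X * derivative Q) -
      C ((α + 1) * b + (β + 1) * a) * derivative Q - C (n * (n + α + β + 1)) * Q = 0 := by
    rw [← h]; simp only [C_add, C_mul, C_1]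
    rw [show (C (2 : ℝ) : ℝ[X]) = 2 from rfl]; ring
  have h5 := congrArg (fun p => p.coeff j) h4
  simp only [coeff_sub, coeff_add, coeff_C_mul, h1, h2, h3, coeff_derivative, coeff_zero] at h5
  push_cast at h5
  linear_combination -h5

lemma jacobiPoly_eval (α β : ℝ) {ρ : ℝ} (hρ : ρ ≠ 0) (σ : ℝ) (n : ℕ) (x : ℝ) :
    (jacobiPoly α β (ρ * (σ + 1)) (ρ * (σ - 1)) n).eval x =
      ρ ^ n * monicJacobi α β n (x / ρ - σ) := by
  simp only [jacobiPoly, monicJacobi, Polynomial.eval_mul, Polynomial.eval_C,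
    Polynomial.eval_finsetSum, Polynomial.eval_pow, Polynomial.eval_sub, Polynomial.eval_X]
  rw [mul_left_comm]
  congr 1
  rw [Finset.mul_sum]
  refine Finset.sum_congr rfl fun k hk => ?_
  have hk : k ≤ n := by simpa [Nat.lt_succ_iff] using hk
  have e1 : x - ρ * (σ + 1) = ρ * (x / ρ - σ - 1) := by field_simp; ring
  have e2 : x - ρ * (σ - 1) = ρ * (x / ρ - σ + 1) := by field_simp; ring
  have e3 : ρ ^ n = ρ ^ (n - k) * ρ ^ k := by rw [← pow_add, Nat.sub_add_cancel hk]
  rw [e1, e2, e3, mul_pow, mul_pow]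
  ring

lemma jacobiRho_inv {s t : ℝ} (hs : 0 < s) (ht : 0 < t) :
    jacobiRho (1 / s) (1 / t) = (s + t) * √(s + t) / (s * t) := by
  have h : 1 / s + 1 / t = (s + t) / (s * t) := by field_simp; ring
  rw [jacobiRho, h, show (3 : ℝ) / 2 = 1 + 1 / 2 by norm_num,
    Real.rpow_add (by positivity), Real.rpow_one, ← Real.sqrt_eq_rpow,
    Real.sqrt_div (by positivity), show 1 / s * (1 / t) = 1 / (s * t) by field_simp,
    Real.sqrt_div zero_le_one, Real.sqrt_one]
  have : √(s * t) ≠ 0 := by positivity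
  field_simp

lemma continuousOn_mul_div_add :
    ContinuousOn (fun p : ℝ × ℝ => p.1 * p.2 / (p.1 + p.2)) (Set.Ici 0 ×ˢ Set.Ici 0) := by
  rintro ⟨s, t⟩ ⟨hs, ht⟩
  simp only [Set.mem_Ici] at hs ht
  rcases (add_nonneg hs ht).eq_or_lt with h | h
  · obtain rfl : s = 0 := by linarith
    obtain rfl : t = 0 := by linarith
    rw [ContinuousWithinAt]
    simp only [mul_zero, zero_div]
    refine squeeze_zero' (g := fun p : ℝ × ℝ => p.1) ?_ ?_ ?_
    · filter_upwards [self_mem_nhdsWithin] with p hp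
      have h1 : 0 ≤ p.1 := hp.1
      have h2 : 0 ≤ p.2 := hp.2
      positivity
    · filter_upwards [self_mem_nhdsWithin] with p hp
      have h1 : 0 ≤ p.1 := hp.1
      have h2 : 0 ≤ p.2 := hp.2
      refine div_le_of_le_mul₀ (by positivity) h1 ?_
      nlinarith
    · exact (continuous_fst.tendsto ((0 : ℝ), (0 : ℝ))).mono_left nhdsWithin_le_nhds
  · exact ContinuousAt.continuousWithinAt (by fun_prop (disch := exact h.ne'))

lemma continuousOn_sub_div_sqrt_add :
    ContinuousOn (fun p : ℝ × ℝ => (p.2 - p.1) / √(p.1 + p.2)) (Set.Ici 0 ×ˢ Set.Ici 0) := by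
  rintro ⟨s, t⟩ ⟨hs, ht⟩
  simp only [Set.mem_Ici] at hs ht
  rcases (add_nonneg hs ht).eq_or_lt with h | h
  · obtain rfl : s = 0 := by linarith
    obtain rfl : t = 0 := by linarith
    rw [ContinuousWithinAt]
    simp only [sub_zero, zero_div]
    refine squeeze_zero_norm' (a := fun p : ℝ × ℝ => √(p.1 + p.2)) ?_ ?_
    · filter_upwards [self_mem_nhdsWithin] with p hp
      have h1 : 0 ≤ p.1 := hp.1
      have h2 : 0 ≤ p.2 := hp.2
      rw [Real.norm_eq_abs, abs_div, abs_of_nonneg (Real.sqrt_nonneg _)]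
      refine div_le_of_le_mul₀ (by positivity) (by positivity) ?_
      rw [Real.mul_self_sqrt (by positivity), abs_le]
      constructor <;> linarith
    · have : Continuous fun p : ℝ × ℝ => √(p.1 + p.2) := by fun_prop
      simpa using (this.tendsto ((0 : ℝ), (0 : ℝ))).mono_left nhdsWithin_le_nhds
  · have : √(s + t) ≠ 0 := by positivity
    exact ContinuousAt.continuousWithinAt (by fun_prop (disch := exact this))

/-- The polynomial in `x` underlying `p_n(x; 1/s, 1/t)`. -/
noncomputable def rescaledJacobiPoly (n : ℕ) (s t : ℝ) : Polynomial ℝ :=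
  jacobiPoly (1 / s) (1 / t)
    (jacobiRho (1 / s) (1 / t) * (jacobiSigma (1 / s) (1 / t) + 1))
    (jacobiRho (1 / s) (1 / t) * (jacobiSigma (1 / s) (1 / t) - 1)) n

lemma rescaledJacobiPoly_coeff_rec {s t : ℝ} (hs : 0 < s) (ht : 0 < t) (n j : ℕ) :
    ((n : ℝ) - j + s * t / (s + t) * (n * (n + 1) - j * (j + 1))) *
      (rescaledJacobiPoly n s t).coeff j =
    -(4 * ((j + 1) * (j + 2)) * (rescaledJacobiPoly n s t).coeff (j + 2)) -
      2 * ((t - s) / √(s + t)) * (j + 1) ^ 2 * (rescaledJacobiPoly n s t).coeff (j + 1) := by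
  have h := jacobiPoly_coeff_rec (1 / s) (1 / t)
    (jacobiRho (1 / s) (1 / t) * (jacobiSigma (1 / s) (1 / t) + 1))
    (jacobiRho (1 / s) (1 / t) * (jacobiSigma (1 / s) (1 / t) - 1)) n j
  rw [← rescaledJacobiPoly] at h
  generalize rescaledJacobiPoly n s t = Q at *
  have hσ : jacobiSigma (1 / s) (1 / t) = (t - s) / (s + t) := by
    rw [jacobiSigma]; field_simp; ring
  rw [jacobiRho_inv hs ht, hσ] at h
  have hw : 0 < √(s + t) := by positivity
  have hw2 : √(s + t) ^ 2 = s + t := Real.sq_sqrt (by positivity)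
  have e1 : s * t / (s + t) * ((n : ℝ) * (n + 1 / s + 1 / t + 1) - j * (j + 1 / s + 1 / t + 1)) =
      (n : ℝ) - j + s * t / (s + t) * (n * (n + 1) - j * (j + 1)) := by
    field_simp; ring
  have e2 : s * t / (s + t) * (((s + t) * √(s + t) / (s * t) * ((t - s) / (s + t) + 1)) *
      ((s + t) * √(s + t) / (s * t) * ((t - s) / (s + t) - 1))) = -4 := by
    field_simp
    rw [hw2]; ring
  have e3 : s * t / (s + t) * (((s + t) * √(s + t) / (s * t) * ((t - s) / (s + t) + 1) +
      (s + t) * √(s + t) / (s * t) * ((t - s) / (s + t) - 1)) * j +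
      (1 / s + 1) * ((s + t) * √(s + t) / (s * t) * ((t - s) / (s + t) - 1)) +
      (1 / t + 1) * ((s + t) * √(s + t) / (s * t) * ((t - s) / (s + t) + 1))) =
      2 * ((t - s) / √(s + t)) * (j + 1) := by
    field_simp
    rw [hw2]; ring
  linear_combination (s * t / (s + t)) * h - Q.coeff j * e1 +
    ((j : ℝ) + 1) * (j + 2) * Q.coeff (j + 2) * e2 - ((j : ℝ) + 1) * Q.coeff (j + 1) * e3

lemma exists_continuousOn_rescaledJacobiPoly_coeff (n m j : ℕ) (hj : n ≤ j + m) :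
    ∃ f : ℝ × ℝ → ℝ, ContinuousOn f (Set.Ici 0 ×ˢ Set.Ici 0) ∧
      ∀ s t : ℝ, 0 < s → 0 < t → f (s, t) = (rescaledJacobiPoly n s t).coeff j := by
  induction m generalizing j with
  | zero =>
    rcases (show n ≤ j from hj).eq_or_lt with rfl | h
    · exact ⟨fun _ => 1, continuousOn_const, fun s t hs ht =>
        (jacobiPoly_coeff_self (by positivity) (by positivity) _ _ _).symm⟩
    · exact ⟨fun _ => 0, continuousOn_const, fun s t hs ht =>
        (Polynomial.coeff_eq_zero_of_natDegree_lt
          ((jacobiPoly_natDegree_le _ _ _ _ _).trans_lt h)).symm⟩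
  | succ m ih =>
    rcases le_or_gt n j with h | h
    · exact ih j (by omega)
    obtain ⟨f, hf, hf'⟩ := ih (j + 1) (by omega)
    obtain ⟨g, hg, hg'⟩ := ih (j + 2) (by omega)
    have hD : ∀ s t : ℝ, 0 ≤ s → 0 ≤ t →
        0 < (n : ℝ) - j + s * t / (s + t) * (n * (n + 1) - j * (j + 1)) := fun s t hs ht => by
      have h' : (j : ℝ) < n := by exact_mod_cast h
      have h0 : (0 : ℝ) ≤ j := j.cast_nonneg
      have : (0 : ℝ) ≤ n * (n + 1) - j * (j + 1) := by nlinarith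
      have : 0 ≤ s * t / (s + t) * (n * (n + 1) - j * (j + 1)) := by positivity
      linarith
    refine ⟨fun p => (-(4 * (((j : ℝ) + 1) * (j + 2)) * g p) -
        2 * ((p.2 - p.1) / √(p.1 + p.2)) * (j + 1) ^ 2 * f p) /
      ((n : ℝ) - j + p.1 * p.2 / (p.1 + p.2) * (n * (n + 1) - j * (j + 1))), ?_, ?_⟩
    · refine ContinuousOn.div ?_ ?_ fun p hp => (hD p.1 p.2 hp.1 hp.2).ne'
      · exact (continuousOn_const.mul hg).neg.sub
          (((continuousOn_const.mul continuousOn_sub_div_sqrt_add).mul continuousOn_const).mul hf)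
      · exact continuousOn_const.add (continuousOn_mul_div_add.mul continuousOn_const)
    · intro s t hs ht
      simp only [hf' s t hs ht, hg' s t hs ht]
      rw [div_eq_iff (hD s t hs.le ht.le).ne', ← rescaledJacobiPoly_coeff_rec hs ht, mul_comm]

/-- `(s,t) ↦ p_n(x; 1/s, 1/t)` extends continuously to the closed quadrant. -/
theorem rescaled_jacobi_continuous_extension (n : ℕ) (x : ℝ) :
    ∃ q : ℝ × ℝ → ℝ, ContinuousOn q (Set.Ici 0 ×ˢ Set.Ici 0) ∧
      ∀ s t : ℝ, 0 < s → 0 < t → q (s, t) = rescaledJacobi (1 / s) (1 / t) n x := by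
  choose f hf hf' using fun j =>
    exists_continuousOn_rescaledJacobiPoly_coeff n n j (Nat.le_add_left n j)
  refine ⟨fun p => ∑ j ∈ Finset.range (n + 1), f j p * x ^ j,
    continuousOn_finsetSum _ fun j _ => (hf j).mul continuousOn_const, fun s t hs ht => ?_⟩
  have hρ : jacobiRho (1 / s) (1 / t) ≠ 0 := by
    rw [jacobiRho_inv hs ht]; positivity
  rw [rescaledJacobi, ← jacobiPoly_eval _ _ hρ, Polynomial.eval_eq_sum_range'
    (Nat.lt_succ_of_le (jacobiPoly_natDegree_le _ _ _ _ n))]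
  exact Finset.sum_congr rfl fun j _ => by rw [hf' j s t hs ht, rescaledJacobiPoly]
end

section
/- Fix an integer n≥1. For s,t,u,v>0 put α=1/s, b=1/t, d=1/u, ν=1/v, and then β=bα, δ=(bdν+1)α, N=bν, ρ=((α+β)³/(αβ(β+δ)(N+α+β)(δ−α)N))^{1/2}, σ=−N(α+1)(β+δ+1)/(α+β+2). Define C_n(s,t,u,v) = ρ²·n(n+α)(n+β)(n+α+β)(n+β+δ)(δ−α−n)(n+N+α+β+1)(N+1−n)/((2n+α+β−1)(2n+α+β)²(2n+α+β+1)) and B_n(s,t,u,v) = ρ·( (n+α+β+1)(n+α+1)(n+β+δ+1)(N−n)/((2n+α+β+1)(2n+α+β+2)) + n(n+β)(δ−α−n)(n+N+α+β+1)/((2n+α+β)(2n+α+β+1)) + σ ). Then both C_n and B_n, defined on the open orthant (0,∞)⁴, extend to continuous functions on the closed orthant [0,∞)⁴. -/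
open Filter Real

/-- The recurrence coefficient `C_n` for the uniformly rescaled monic Racah polynomials,
as a function of `α, b, d, ν`. -/
noncomputable def racahCcoeff (n : ℕ) (α b d ν : ℝ) : ℝ :=
  racahRho α b d ν ^ 2 *
    (n * (n + α) * (n + b * α) * (n + α + b * α) * (n + b * α + (b * d * ν + 1) * α) *
        ((b * d * ν + 1) * α - α - n) * (n + b * ν + α + b * α + 1) * (b * ν + 1 - n)) /
    ((2 * n + α + b * α - 1) * (2 * n + α + b * α) ^ 2 * (2 * n + α + b * α + 1))

/-- The recurrence coefficient `B_n` for the uniformly rescaled monic Racah polynomials,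
as a function of `α, b, d, ν`. -/
noncomputable def racahBcoeff (n : ℕ) (α b d ν : ℝ) : ℝ :=
  racahRho α b d ν *
    ((n + α + b * α + 1) * (n + α + 1) * (n + b * α + (b * d * ν + 1) * α + 1) * (b * ν - n) /
        ((2 * n + α + b * α + 1) * (2 * n + α + b * α + 2))
      + n * (n + b * α) * ((b * d * ν + 1) * α - α - n) * (n + b * ν + α + b * α + 1) /
        ((2 * n + α + b * α) * (2 * n + α + b * α + 1))
      + racahSigma α b d ν)

open Topology in
/-- If `0 ≤ f ≤ L` on `S`, then `f / √L` is continuous on `S`, also at the zeros of `L`. -/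
theorem ContinuousOn.div_sqrt_of_le {X : Type*} [TopologicalSpace X] {S : Set X} {f L : X → ℝ}
    (hf : ContinuousOn f S) (hL : ContinuousOn L S) (h0 : ∀ x ∈ S, 0 ≤ f x)
    (hfL : ∀ x ∈ S, f x ≤ L x) : ContinuousOn (fun x => f x / √(L x)) S := by
  intro x hx
  have hsqrt : ContinuousWithinAt (fun y => √(L y)) S x := (hL x hx).sqrt
  by_cases hLx : L x = 0
  · have hlim : Tendsto (fun y => √(L y)) (𝓝[S] x) (𝓝 0) := by
      simpa [ContinuousWithinAt, hLx] using hsqrt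
    have : Tendsto (fun y => f y / √(L y)) (𝓝[S] x) (𝓝 0) := by
      refine squeeze_zero' ?_ ?_ hlim
      · filter_upwards [self_mem_nhdsWithin] with y hy
        exact div_nonneg (h0 y hy) (sqrt_nonneg _)
      · filter_upwards [self_mem_nhdsWithin] with y hy
        calc f y / √(L y) ≤ L y / √(L y) :=
              div_le_div_of_nonneg_right (hfL y hy) (sqrt_nonneg _)
          _ = √(L y) := div_sqrt
    simpa [ContinuousWithinAt, hLx] using this
  · have hpos : 0 < L x := lt_of_le_of_ne ((h0 x hx).trans (hfL x hx)) (Ne.symm hLx)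
    exact (hf x hx).div hsqrt (sqrt_pos.2 hpos).ne'

/-- The closed orthant `[0,∞)⁴`. -/
def closedOrthant : Set (ℝ × ℝ × ℝ × ℝ) :=
  Set.Ici 0 ×ˢ (Set.Ici 0 ×ˢ (Set.Ici 0 ×ˢ Set.Ici 0))

theorem continuousOn_fst_div_sqrt :
    ContinuousOn (fun p : ℝ × ℝ × ℝ × ℝ => p.1 / √(p.1 + p.2.2.2 * (1 + p.2.1)))
      closedOrthant := by
  refine ContinuousOn.div_sqrt_of_le (by fun_prop) (by fun_prop) ?_ ?_
  · rintro ⟨s, t, u, v⟩ ⟨hs, ht, hu, hv⟩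
    exact hs
  · rintro ⟨s, t, u, v⟩ ⟨hs, ht, hu, hv⟩
    simp only [Set.mem_Ici] at hs ht hu hv ⊢
    have : 0 ≤ v * (1 + t) := by positivity
    linarith

theorem continuousOn_snd_div_sqrt :
    ContinuousOn (fun p : ℝ × ℝ × ℝ × ℝ => p.2.2.2 / √(p.1 + p.2.2.2 * (1 + p.2.1)))
      closedOrthant := by
  refine ContinuousOn.div_sqrt_of_le (by fun_prop) (by fun_prop) ?_ ?_
  · rintro ⟨s, t, u, v⟩ ⟨hs, ht, hu, hv⟩
    exact hv
  · rintro ⟨s, t, u, v⟩ ⟨hs, ht, hu, hv⟩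
    simp only [Set.mem_Ici] at hs ht hu hv ⊢
    have : 0 ≤ v * t := by positivity
    linarith

/-- The linear form `1 + t + k s t`, which is `s t (k + α + β)`. -/
def racahDen (k : ℝ) (p : ℝ × ℝ × ℝ × ℝ) : ℝ := 1 + p.2.1 + k * p.1 * p.2.1

/-- The polynomial `1 + u v (1 + t)`, which is `s t u v (β + δ)`. -/
def racahE (p : ℝ × ℝ × ℝ × ℝ) : ℝ := 1 + p.2.2.1 * p.2.2.2 * (1 + p.2.1)

theorem racahDen_pos {k : ℝ} (hk : 0 ≤ k) {p : ℝ × ℝ × ℝ × ℝ} (hp : p ∈ closedOrthant) :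
    0 < racahDen k p := by
  obtain ⟨s, t, u, v⟩ := p
  obtain ⟨hs, ht, hu, hv⟩ := hp
  simp only [Set.mem_Ici] at hs ht hu hv
  unfold racahDen
  positivity

theorem racahE_pos {p : ℝ × ℝ × ℝ × ℝ} (hp : p ∈ closedOrthant) : 0 < racahE p := by
  obtain ⟨s, t, u, v⟩ := p
  obtain ⟨hs, ht, hu, hv⟩ := hp
  simp only [Set.mem_Ici] at hs ht hu hv
  unfold racahE
  positivity

@[fun_prop]
theorem continuous_racahDen (k : ℝ) : Continuous (racahDen k) := by
  unfold racahDen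
  fun_prop

@[fun_prop]
theorem continuous_racahE : Continuous racahE := by
  unfold racahE
  fun_prop

/-- The continuous extension of `C_n` to the closed orthant. -/
noncomputable def racahCExt (n : ℕ) (p : ℝ × ℝ × ℝ × ℝ) : ℝ :=
  n * (1 + p.2.1) ^ 3 * (1 + n * p.1) * (1 + n * p.1 * p.2.1) * racahDen n p *
      (racahE p + n * p.1 * p.2.1 * p.2.2.1 * p.2.2.2) *
      (1 - n * p.1 * p.2.1 * p.2.2.1 * p.2.2.2) * (1 - (n - 1) * p.2.1 * p.2.2.2) *
      (1 + (n + 1) * p.2.1 * ((p.1 / √(p.1 + p.2.2.2 * (1 + p.2.1))) *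
        (p.2.2.2 / √(p.1 + p.2.2.2 * (1 + p.2.1))))) /
    (racahE p * racahDen (2 * n - 1) p * racahDen (2 * n) p ^ 2 * racahDen (2 * n + 1) p)

theorem continuousOn_racahCExt {n : ℕ} (hn : 1 ≤ n) :
    ContinuousOn (racahCExt n) closedOrthant := by
  have hn' : (1 : ℝ) ≤ n := by exact_mod_cast hn
  have h1 := continuousOn_fst_div_sqrt
  have h2 := continuousOn_snd_div_sqrt
  unfold racahCExt
  refine ContinuousOn.div ?_ (by fun_prop) ?_
  · refine ContinuousOn.mul (by fun_prop) (continuousOn_const.add ?_)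
    exact ContinuousOn.mul (by fun_prop) (h1.mul h2)
  · intro p hp
    have e := racahE_pos hp
    have d0 := racahDen_pos (k := 2 * n - 1) (by linarith) hp
    have d1 := racahDen_pos (k := 2 * n) (by linarith) hp
    have d2 := racahDen_pos (k := 2 * n + 1) (by linarith) hp
    positivity

theorem racah_radicand_eq {s t u v : ℝ} (hs : 0 < s) (ht : 0 < t) (hu : 0 < u) (hv : 0 < v) :
    (1 / s + 1 / t * (1 / s)) ^ 3 /
      (1 / s * (1 / t * (1 / s)) * (1 / t * (1 / s) + (1 / t * (1 / u) * (1 / v) + 1) * (1 / s)) *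
        (1 / t * (1 / v) + 1 / s + 1 / t * (1 / s)) *
        ((1 / t * (1 / u) * (1 / v) + 1) * (1 / s) - 1 / s) * (1 / t * (1 / v))) =
    (1 + t) ^ 3 / (1 + u * v * (1 + t)) * (s * t * u * v ^ 2) ^ 2 / (s + v * (1 + t)) := by
  have e1 : 1 / s + 1 / t * (1 / s) = (1 + t) / (s * t) := by field_simp; ring
  have e2 : 1 / t * (1 / s) + (1 / t * (1 / u) * (1 / v) + 1) * (1 / s) =
      (1 + u * v * (1 + t)) / (s * t * u * v) := by field_simp; ring
  have e3 : 1 / t * (1 / v) + 1 / s + 1 / t * (1 / s) = (s + v * (1 + t)) / (s * t * v) := by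
    field_simp; ring
  have e4 : (1 / t * (1 / u) * (1 / v) + 1) * (1 / s) - 1 / s = 1 / (s * t * u * v) := by
    field_simp; ring
  rw [e1, e2, e3, e4]
  have : 0 < 1 + u * v * (1 + t) := by positivity
  have : 0 < s + v * (1 + t) := by positivity
  field_simp

theorem racahRho_eq {s t u v : ℝ} (hs : 0 < s) (ht : 0 < t) (hu : 0 < u) (hv : 0 < v) :
    racahRho (1 / s) (1 / t) (1 / u) (1 / v) =
      √((1 + t) ^ 3 / (1 + u * v * (1 + t))) * (s * t * u * v ^ 2) / √(s + v * (1 + t)) := by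
  rw [racahRho, racah_radicand_eq hs ht hu hv, sqrt_div (by positivity), sqrt_mul (by positivity),
    sqrt_sq (by positivity)]

theorem racahCExt_eq {n : ℕ} (hn : 1 ≤ n) {s t u v : ℝ} (hs : 0 < s) (ht : 0 < t) (hu : 0 < u)
    (hv : 0 < v) :
    racahCExt n (s, t, u, v) = racahCcoeff n (1 / s) (1 / t) (1 / u) (1 / v) := by
  have hn' : (1 : ℝ) ≤ n := by exact_mod_cast hn
  have hp : (s, t, u, v) ∈ closedOrthant := ⟨hs.le, ht.le, hu.le, hv.le⟩
  have e := racahE_pos hp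
  have d0 := racahDen_pos (k := 2 * n - 1) (by linarith) hp
  have d1 := racahDen_pos (k := 2 * n) (by linarith) hp
  have d2 := racahDen_pos (k := 2 * n + 1) (by linarith) hp
  have hL : 0 < s + v * (1 + t) := by positivity
  have hk (k : ℝ) : k + 1 / s + 1 / t * (1 / s) = racahDen k (s, t, u, v) / (s * t) := by
    simp only [racahDen]; field_simp; ring
  have f1 : (n : ℝ) + 1 / s = (1 + n * s) / s := by field_simp; ring
  have f2 : (n : ℝ) + 1 / t * (1 / s) = (1 + n * s * t) / (s * t) := by field_simp; ring
  have f3 : (n : ℝ) + 1 / t * (1 / s) + (1 / t * (1 / u) * (1 / v) + 1) * (1 / s) =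
      (racahE (s, t, u, v) + n * s * t * u * v) / (s * t * u * v) := by
    simp only [racahE]; field_simp; ring
  have f4 : (1 / t * (1 / u) * (1 / v) + 1) * (1 / s) - 1 / s - n =
      (1 - n * s * t * u * v) / (s * t * u * v) := by field_simp; ring
  have f5 : (n : ℝ) + 1 / t * (1 / v) + 1 / s + 1 / t * (1 / s) + 1 =
      (s + v * (1 + t) + (n + 1) * t * (s * v)) / (s * t * v) := by field_simp; ring
  have f6 : 1 / t * (1 / v) + 1 - n = (1 - (n - 1) * t * v) / (t * v) := by field_simp; ring
  have g0 : 2 * (n : ℝ) + 1 / s + 1 / t * (1 / s) - 1 =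
      racahDen (2 * n - 1) (s, t, u, v) / (s * t) := by rw [← hk]; ring
  have g2 : 2 * (n : ℝ) + 1 / s + 1 / t * (1 / s) + 1 =
      racahDen (2 * n + 1) (s, t, u, v) / (s * t) := by rw [← hk]; ring
  have hq : s / √(s + v * (1 + t)) * (v / √(s + v * (1 + t))) = s * v / (s + v * (1 + t)) := by
    rw [div_mul_div_comm, mul_self_sqrt hL.le]
  rw [racahCcoeff, racahRho, sq_sqrt, racah_radicand_eq hs ht hu hv, g0, g2, f3, f5, f4, f6, hk, hk,
    f1, f2, racahCExt]
  · simp only [hq]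
    have hE : 1 + u * v * (1 + t) = racahE (s, t, u, v) := rfl
    rw [hE]
    generalize racahE (s, t, u, v) = E at *
    generalize racahDen (2 * n - 1) (s, t, u, v) = D0 at *
    generalize racahDen (2 * n) (s, t, u, v) = D1 at *
    generalize racahDen (2 * n + 1) (s, t, u, v) = D2 at *
    field_simp
  · rw [racah_radicand_eq hs ht hu hv]
    positivity

/-- With `B_n = √((1+t)³/E) (s G + v H) / √(s + v (1+t))`, this is the contribution to `G` of the
first term of `B_n` and of `σ`, where the common value `E / (1+t)` of both at `s = v = 0`
has been cancelled. -/
noncomputable def racahBLead (n : ℕ) (p : ℝ × ℝ × ℝ × ℝ) : ℝ :=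
  let s := p.1
  let t := p.2.1
  let v := p.2.2.2
  let w := p.2.1 * p.2.2.1 * p.2.2.2
  let a := (n + 1) * t / racahDen (2 * n + 2) p
  let b := (2 * n + 1) * t / racahDen (2 * n + 1) p
  let c := 2 * t / racahDen 2 p
  let Q := (n + 1) - a - b + s * (a * b - (n + 1) * a - (n + 1) * b) + s ^ 2 * (n + 1) * a * b
  let R := 1 - c - s * c
  (((n + 1) * w + Q * racahE p + s * Q * (n + 1) * w) * (1 - n * t * v) -
    (w + R * racahE p + s * R * w)) / (1 + t)

/-- The second term of `B_n`, divided by `s ((n+1) t v + 1) + v (1+t)`. -/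
noncomputable def racahBRest (n : ℕ) (p : ℝ × ℝ × ℝ × ℝ) : ℝ :=
  n * (1 + n * p.1 * p.2.1) * (1 - n * p.1 * p.2.1 * p.2.2.1 * p.2.2.2) /
    (racahDen (2 * n) p * racahDen (2 * n + 1) p)

/-- The continuous extension of `B_n` to the closed orthant. -/
noncomputable def racahBExt (n : ℕ) (p : ℝ × ℝ × ℝ × ℝ) : ℝ :=
  √((1 + p.2.1) ^ 3 / racahE p) *
    (p.1 / √(p.1 + p.2.2.2 * (1 + p.2.1)) *
        (racahBLead n p + racahBRest n p * ((n + 1) * p.2.1 * p.2.2.2 + 1)) +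
      p.2.2.2 / √(p.1 + p.2.2.2 * (1 + p.2.1)) *
        (racahBRest n p * (1 + p.2.1) - n * p.2.1 * racahE p / (1 + p.2.1)))

theorem continuousOn_racahBExt (n : ℕ) : ContinuousOn (racahBExt n) closedOrthant := by
  have hE : ∀ p ∈ closedOrthant, racahE p ≠ 0 := fun p hp => (racahE_pos hp).ne'
  have hW : ∀ p ∈ closedOrthant, 1 + p.2.1 ≠ 0 := by
    rintro ⟨s, t, u, v⟩ ⟨hs, ht, hu, hv⟩
    simp only [Set.mem_Ici] at hs ht hu hv ⊢
    positivity
  have d0 : ∀ p ∈ closedOrthant, racahDen (2 * n) p ≠ 0 :=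
    fun p hp => (racahDen_pos (by positivity) hp).ne'
  have d1 : ∀ p ∈ closedOrthant, racahDen (2 * n + 1) p ≠ 0 :=
    fun p hp => (racahDen_pos (by positivity) hp).ne'
  have d2 : ∀ p ∈ closedOrthant, racahDen (2 * n + 2) p ≠ 0 :=
    fun p hp => (racahDen_pos (by positivity) hp).ne'
  have d3 : ∀ p ∈ closedOrthant, racahDen 2 p ≠ 0 :=
    fun p hp => (racahDen_pos (by positivity) hp).ne'
  have hlead : ContinuousOn (racahBLead n) closedOrthant := by
    have ha : ContinuousOn (fun p : ℝ × ℝ × ℝ × ℝ =>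
        (n + 1) * p.2.1 / racahDen (2 * n + 2) p) closedOrthant :=
      ContinuousOn.div (by fun_prop) (by fun_prop) d2
    have hb : ContinuousOn (fun p : ℝ × ℝ × ℝ × ℝ =>
        (2 * n + 1) * p.2.1 / racahDen (2 * n + 1) p) closedOrthant :=
      ContinuousOn.div (by fun_prop) (by fun_prop) d1
    have hc : ContinuousOn (fun p : ℝ × ℝ × ℝ × ℝ => 2 * p.2.1 / racahDen 2 p) closedOrthant :=
      ContinuousOn.div (by fun_prop) (by fun_prop) d3
    unfold racahBLead
    refine ContinuousOn.div ?_ (by fun_prop) hW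
    fun_prop
  have hrest : ContinuousOn (racahBRest n) closedOrthant := by
    unfold racahBRest
    exact ContinuousOn.div (by fun_prop) (by fun_prop)
      fun p hp => mul_ne_zero (d0 p hp) (d1 p hp)
  have h1 := continuousOn_fst_div_sqrt
  have h2 := continuousOn_snd_div_sqrt
  unfold racahBExt
  refine ContinuousOn.mul (by fun_prop (disch := assumption)) ((h1.mul ?_).add (h2.mul ?_))
  · fun_prop
  · fun_prop (disch := assumption)

/-- The difference of the first term of `B_n` and `-σ`, both scaled by `s t u v²`, lies in the ideal
generated by `s` and `v`. -/
theorem racahBLead_eq (n : ℕ) {s t u v : ℝ} (hs : 0 < s) (ht : 0 < t) (hu : 0 < u)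
    (hv : 0 < v) :
    racahDen (n + 1) (s, t, u, v) * (1 + (n + 1) * s) *
          (racahE (s, t, u, v) + (n + 1) * s * t * u * v) * (1 - n * t * v) /
        (racahDen (2 * n + 1) (s, t, u, v) * racahDen (2 * n + 2) (s, t, u, v)) -
      (1 + s) * (racahE (s, t, u, v) + s * t * u * v) / racahDen 2 (s, t, u, v) =
    s * racahBLead n (s, t, u, v) - v * (n * t * racahE (s, t, u, v) / (1 + t)) := by
  have hp : (s, t, u, v) ∈ closedOrthant := ⟨hs.le, ht.le, hu.le, hv.le⟩
  have d1 := racahDen_pos (k := 2 * n + 1) (by positivity) hp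
  have d2 := racahDen_pos (k := 2 * n + 2) (by positivity) hp
  have d3 := racahDen_pos (k := 2) (by positivity) hp
  have hW : 0 < 1 + t := by positivity
  have ha : racahDen (n + 1) (s, t, u, v) / racahDen (2 * n + 2) (s, t, u, v) =
      1 - s * ((n + 1) * t / racahDen (2 * n + 2) (s, t, u, v)) := by
    have : racahDen (n + 1) (s, t, u, v) =
        racahDen (2 * n + 2) (s, t, u, v) - s * ((n + 1) * t) := by
      simp only [racahDen]
      ring
    rw [this, sub_div, div_self d2.ne', mul_div_assoc]
  have hb : 1 / racahDen (2 * n + 1) (s, t, u, v) =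
      (1 - s * ((2 * n + 1) * t / racahDen (2 * n + 1) (s, t, u, v))) / (1 + t) := by
    field_simp
    simp only [racahDen]
    ring
  have hc : 1 / racahDen 2 (s, t, u, v) =
      (1 - s * (2 * t / racahDen 2 (s, t, u, v))) / (1 + t) := by
    field_simp
    simp only [racahDen]
    ring
  have hsplit : ∀ k x y z D1 D2 : ℝ,
      k * x * y * z / (D1 * D2) = k / D2 * (1 / D1) * x * y * z := by
    intros; ring
  rw [hsplit, ha, hb, div_eq_mul_one_div _ (racahDen 2 _), hc]
  simp only [racahBLead]
  generalize (2 * n + 1) * t / racahDen (2 * n + 1) (s, t, u, v) = b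
  generalize (n + 1) * t / racahDen (2 * n + 2) (s, t, u, v) = a
  generalize 2 * t / racahDen 2 (s, t, u, v) = c
  field_simp
  ring

theorem racahBExt_eq {n : ℕ} {s t u v : ℝ} (hs : 0 < s) (ht : 0 < t) (hu : 0 < u) (hv : 0 < v) :
    racahBExt n (s, t, u, v) = racahBcoeff n (1 / s) (1 / t) (1 / u) (1 / v) := by
  have hp : (s, t, u, v) ∈ closedOrthant := ⟨hs.le, ht.le, hu.le, hv.le⟩
  have d0 := racahDen_pos (k := 2 * n) (by positivity) hp
  have d1 := racahDen_pos (k := 2 * n + 1) (by positivity) hp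
  have d2 := racahDen_pos (k := 2 * n + 2) (by positivity) hp
  have d3 := racahDen_pos (k := 2) (by positivity) hp
  have hk (k : ℝ) : k + 1 / s + 1 / t * (1 / s) = racahDen k (s, t, u, v) / (s * t) := by
    simp only [racahDen]; field_simp; ring
  have g0 : (n : ℝ) + 1 / s + 1 / t * (1 / s) + 1 =
      racahDen (n + 1) (s, t, u, v) / (s * t) := by rw [← hk]; ring
  have g1 : 2 * (n : ℝ) + 1 / s + 1 / t * (1 / s) + 1 =
      racahDen (2 * n + 1) (s, t, u, v) / (s * t) := by rw [← hk]; ring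
  have g2 : 2 * (n : ℝ) + 1 / s + 1 / t * (1 / s) + 2 =
      racahDen (2 * n + 2) (s, t, u, v) / (s * t) := by rw [← hk]; ring
  have g3 : 1 / s + 1 / t * (1 / s) + 2 = racahDen 2 (s, t, u, v) / (s * t) := by
    rw [← hk]; ring
  have f1 : (n : ℝ) + 1 / s + 1 = (1 + (n + 1) * s) / s := by field_simp; ring
  have f2 : (n : ℝ) + 1 / t * (1 / s) = (1 + n * s * t) / (s * t) := by field_simp; ring
  have f3 : (n : ℝ) + 1 / t * (1 / s) + (1 / t * (1 / u) * (1 / v) + 1) * (1 / s) + 1 =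
      (racahE (s, t, u, v) + (n + 1) * s * t * u * v) / (s * t * u * v) := by
    simp only [racahE]; field_simp; ring
  have f4 : (1 / t * (1 / u) * (1 / v) + 1) * (1 / s) - 1 / s - n =
      (1 - n * s * t * u * v) / (s * t * u * v) := by field_simp; ring
  have f5 : (n : ℝ) + 1 / t * (1 / v) + 1 / s + 1 / t * (1 / s) + 1 =
      (s * ((n + 1) * t * v + 1) + v * (1 + t)) / (s * t * v) := by field_simp; ring
  have f6 : 1 / t * (1 / v) - n = (1 - n * t * v) / (t * v) := by field_simp
  have f7 : 1 / t * (1 / s) + (1 / t * (1 / u) * (1 / v) + 1) * (1 / s) + 1 =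
      (racahE (s, t, u, v) + s * t * u * v) / (s * t * u * v) := by
    simp only [racahE]; field_simp; ring
  have f8 : 1 / s + 1 = (1 + s) / s := by field_simp
  have key := racahBLead_eq n hs ht hu hv
  have hbracket : ∀ x D0 D1 D2 D3 A1 A2 A3 A4 B1 B2 B3 C1 C2 : ℝ,
      0 < D0 → 0 < D1 → 0 < D2 → 0 < D3 →
      x * (s * t * u * v ^ 2) * (A1 / (s * t) * (A2 / s) * (A3 / (s * t * u * v)) * (A4 / (t * v)) /
          (D1 / (s * t) * (D2 / (s * t))) +
        n * (B1 / (s * t)) * (B2 / (s * t * u * v)) * (B3 / (s * t * v)) /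
          (D0 / (s * t) * (D1 / (s * t))) +
        -(1 / t * (1 / v) * (C1 / s) * (C2 / (s * t * u * v))) / (D3 / (s * t))) =
      x * ((A1 * A2 * A3 * A4 / (D1 * D2) - C1 * C2 / D3) + n * B1 * B2 / (D0 * D1) * B3) := by
    intro x D0 D1 D2 D3 A1 A2 A3 A4 B1 B2 B3 C1 C2 h0 h1 h2 h3
    field_simp
    ring
  rw [racahBcoeff, racahSigma, racahRho_eq hs ht hu hv, g0, g1, g2, g3, f3, f5, f4, f6, f7, f1, f2,
    f8, hk, mul_div_right_comm, hbracket _ _ _ _ _ _ _ _ _ _ _ _ _ _ d0 d1 d2 d3, key, racahBExt]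
  simp only [racahBRest]
  have hE : 1 + u * v * (1 + t) = racahE (s, t, u, v) := rfl
  rw [hE]
  ring

/-- both recurrence coefficients, expressed in
`(s,t,u,v) = (1/α, 1/b, 1/d, 1/ν)`, extend continuously to the closed orthant `[0,∞)⁴`. -/
theorem racah_coefficients_continuous_extension (n : ℕ) (hn : 1 ≤ n) :
    (∃ C : ℝ × ℝ × ℝ × ℝ → ℝ,
      ContinuousOn C (Set.Ici 0 ×ˢ (Set.Ici 0 ×ˢ (Set.Ici 0 ×ˢ Set.Ici 0))) ∧
      ∀ s t u v : ℝ, 0 < s → 0 < t → 0 < u → 0 < v →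
        C (s, t, u, v) = racahCcoeff n (1 / s) (1 / t) (1 / u) (1 / v)) ∧
    (∃ B : ℝ × ℝ × ℝ × ℝ → ℝ,
      ContinuousOn B (Set.Ici 0 ×ˢ (Set.Ici 0 ×ˢ (Set.Ici 0 ×ˢ Set.Ici 0))) ∧
      ∀ s t u v : ℝ, 0 < s → 0 < t → 0 < u → 0 < v →
        B (s, t, u, v) = racahBcoeff n (1 / s) (1 / t) (1 / u) (1 / v)) := by
  exact ⟨⟨racahCExt n, continuousOn_racahCExt hn, fun s t u v hs ht hu hv =>
      racahCExt_eq hn hs ht hu hv⟩,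
    ⟨racahBExt n, continuousOn_racahBExt n, fun s t u v hs ht hu hv =>
      racahBExt_eq hs ht hu hv⟩⟩
end
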